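/- There exists N ∈ ℕ such that for all n ≥ N and all sets E1, E2, E3 ⊆ F_2^n with P(E1×E2×E3) ≥ n^{−1/100}, the average over coordinates i ∈ {1,...,n} of the value in the i-th coordinate of the n-fold GHZ game conditioned on E1×E2×E3 is at most 19/20: (1/n) Σ_{i=1}^{n} val^{(i)}(G | E1×E2×E3) ≤ 19/20. -/

import Mathlib

/-- Vectors of length `n` over `F_2`. -/
abbrev Vec (n : ℕ) := Fin n → ZMod 2

/-- Boolean OR of three bits: `0` iff all three bits are `0`. -/
def or3 (u v w : ZMod 2) : ZMod 2 := if u = 0 ∧ v = 0 ∧ w = 0 then 0 else 1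

/-- The players win coordinate `i` on query `(x, y, x+y)` with strategy `f1, f2, f3`. -/
def winCoord {n : ℕ} (f1 f2 f3 : Vec n → Vec n) (x y : Vec n) (i : Fin n) : Prop :=
  f1 x i + f2 y i + f3 (x + y) i = or3 (x i) (y i) ((x + y) i)

/-- The event `E1 × E2 × E3`, viewed as a set of pairs `(x, y)` (with `z = x + y`):
the support of `P | E` in the parametrization of the GHZ query distribution by `(x, y)`. -/
def condSet {n : ℕ} (E1 E2 E3 : Set (Vec n)) : Set (Vec n × Vec n) :=
  {p | p.1 ∈ E1 ∧ p.2 ∈ E2 ∧ p.1 + p.2 ∈ E3}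

/-- The probability of `E1 × E2 × E3` under the `n`-fold GHZ query distribution. -/
noncomputable def probE {n : ℕ} (E1 E2 E3 : Set (Vec n)) : ℝ :=
  (Nat.card (condSet E1 E2 E3) : ℝ) / (2 : ℝ) ^ (2 * n)

/-- `val^{(i)}(G | E)`: the maximum, over strategies, of the probability under `P | E`
of winning coordinate `i` of the `n`-fold GHZ game. -/
noncomputable def valCoord {n : ℕ} (E1 E2 E3 : Set (Vec n)) (i : Fin n) : ℝ :=
  ⨆ f : (Vec n → Vec n) × (Vec n → Vec n) × (Vec n → Vec n),
    (Nat.card {p : Vec n × Vec n // p ∈ condSet E1 E2 E3 ∧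
        winCoord f.1 f.2.1 f.2.2 p.1 p.2 i} : ℝ) / (Nat.card (condSet E1 E2 E3) : ℝ)

open scoped BigOperators

/-- The sign `(-1) ^ (a * b)` of two bits. -/
def bitSign (a b : ZMod 2) : ℝ := if a = 1 ∧ b = 1 then -1 else 1

/-- The real character of `F_2^n` attached to `r`. -/
def walsh {n : ℕ} (r x : Vec n) : ℝ := ∏ i, bitSign (r i) (x i)

lemma bitSign_add (a b c : ZMod 2) : bitSign a (b + c) = bitSign a b * bitSign a c := by
  have h : (1 : ZMod 2) + 1 = 0 := by decide
  have h01 : ∀ b : ZMod 2, b = 0 ∨ b = 1 := by decide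
  rcases h01 b with rfl | rfl <;> rcases h01 c with rfl | rfl <;> by_cases ha : a = 1 <;>
    simp [bitSign, h, ha]

lemma sum_bitSign (b : ZMod 2) : ∑ a, bitSign a b = if b = 0 then 2 else 0 := by
  have h : (Finset.univ : Finset (ZMod 2)) = {0, 1} := by decide
  have h01 : b = 0 ∨ b = 1 := by revert b; decide
  rw [h, Finset.sum_pair (by decide)]
  rcases h01 with rfl | rfl <;> norm_num [bitSign]

lemma walsh_add {n : ℕ} (r x y : Vec n) : walsh r (x + y) = walsh r x * walsh r y := by
  simp [walsh, bitSign_add, Finset.prod_mul_distrib]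

lemma walsh_eq_one_or {n : ℕ} (r x : Vec n) : walsh r x = 1 ∨ walsh r x = -1 := by
  have h : walsh r x * walsh r x = 1 := by
    simp only [walsh, ← Finset.prod_mul_distrib]
    refine Finset.prod_eq_one fun i _ => ?_
    unfold bitSign
    split_ifs <;> norm_num
  exact mul_self_eq_one_iff.1 h

lemma sum_walsh {n : ℕ} (x : Vec n) : ∑ r, walsh r x = if x = 0 then 2 ^ n else 0 := by
  have h : ∑ r : Vec n, walsh r x = ∏ i, ∑ a, bitSign a (x i) := by
    rw [Finset.prod_univ_sum]
    simp [walsh]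
  rw [h]
  simp only [sum_bitSign]
  split_ifs with hx
  · simp [hx]
  · obtain ⟨i, hi⟩ := Function.ne_iff.1 hx
    exact Finset.prod_eq_zero (Finset.mem_univ i) (by simpa using hi)

lemma vec_add_self {n : ℕ} (x : Vec n) : x + x = 0 :=
  funext fun i => CharTwo.add_self_eq_zero (x i)

lemma vec_add_eq_zero {n : ℕ} (x y : Vec n) : x + y = 0 ↔ x = y := by
  refine ⟨fun h => ?_, fun h => h ▸ vec_add_self x⟩
  rw [← add_zero x, ← vec_add_self y, ← add_assoc, h, zero_add]

lemma parseval {n : ℕ} (V : Finset (Vec n)) (F : Vec n → ℝ) :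
    ∑ r, (∑ x ∈ V, F x * walsh r x) ^ 2 = 2 ^ n * ∑ x ∈ V, F x ^ 2 := by
  have h (r : Vec n) : (∑ x ∈ V, F x * walsh r x) ^ 2
      = ∑ x ∈ V, ∑ y ∈ V, F x * F y * walsh r (x + y) := by
    rw [sq, Finset.sum_mul_sum]
    refine Finset.sum_congr rfl fun x _ => Finset.sum_congr rfl fun y _ => ?_
    rw [walsh_add]; ring
  simp_rw [h]
  rw [Finset.sum_comm, Finset.mul_sum]
  refine Finset.sum_congr rfl fun x hx => ?_
  rw [Finset.sum_comm]
  simp_rw [← Finset.mul_sum, sum_walsh, vec_add_eq_zero]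
  simp [hx]
  ring

/-- The finite set `V` is a linear subspace of `F_2^n`. -/
structure IsSub {n : ℕ} (V : Finset (Vec n)) : Prop where
  zero_mem : 0 ∈ V
  add_mem : ∀ x ∈ V, ∀ y ∈ V, x + y ∈ V

namespace IsSub

variable {n : ℕ} {V : Finset (Vec n)}

lemma add_mem_iff (hV : IsSub V) {u : Vec n} (hu : u ∈ V) (x : Vec n) : x + u ∈ V ↔ x ∈ V := by
  refine ⟨fun h => ?_, fun h => hV.add_mem x h u hu⟩
  simpa [add_assoc, vec_add_self] using hV.add_mem _ h u hu

lemma card_pos (hV : IsSub V) : 0 < V.card := Finset.card_pos.2 ⟨0, hV.zero_mem⟩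

lemma sum_shift (hV : IsSub V) {u : Vec n} (hu : u ∈ V) (F : Vec n → ℝ) :
    ∑ x ∈ V, F (x + u) = ∑ x ∈ V, F x :=
  Finset.sum_equiv (Equiv.addRight u) (fun x => by simp [hV.add_mem_iff hu]) (fun x _ => rfl)

lemma sum_shift' (hV : IsSub V) {u : Vec n} (hu : u ∈ V) (F : Vec n → ℝ) :
    ∑ x ∈ V, F (u + x) = ∑ x ∈ V, F x := by
  simpa [add_comm] using hV.sum_shift hu F

lemma expect_shift (hV : IsSub V) {u : Vec n} (hu : u ∈ V) (F : Vec n → ℝ) :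
    𝔼 x ∈ V, F (x + u) = 𝔼 x ∈ V, F x := by
  simp [Finset.expect_eq_sum_div_card, hV.sum_shift hu]

lemma expect_shift' (hV : IsSub V) {u : Vec n} (hu : u ∈ V) (F : Vec n → ℝ) :
    𝔼 x ∈ V, F (u + x) = 𝔼 x ∈ V, F x := by
  simp [Finset.expect_eq_sum_div_card, hV.sum_shift' hu]

lemma sq_sum_walsh (hV : IsSub V) (F : Vec n → ℝ) (r : Vec n) :
    (∑ x ∈ V, F x * walsh r x) ^ 2
      = ∑ t ∈ V, (∑ x ∈ V, F x * F (x + t)) * walsh r t := by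
  simp_rw [Finset.sum_mul]
  rw [Finset.sum_comm, sq, Finset.sum_mul_sum]
  refine Finset.sum_congr rfl fun x hx => ?_
  rw [← hV.sum_shift' hx]
  refine Finset.sum_congr rfl fun t _ => ?_
  rw [walsh_add]
  rcases walsh_eq_one_or r x with h | h <;> rw [h] <;> ring

/-- If all Walsh coefficients of `F` on `V` are at most `ε`, the autocorrelation of `F` is
small in mean square. -/
lemma expect_sq_autocorrelation_le (hV : IsSub V) (F : Vec n → ℝ) (hF : ∀ x, |F x| ≤ 1) {ε : ℝ}
    (hε : ∀ r, |𝔼 x ∈ V, F x * walsh r x| ≤ ε) :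
    𝔼 t ∈ V, (𝔼 x ∈ V, F x * F (x + t)) ^ 2 ≤ ε ^ 2 := by
  have hN : (0 : ℝ) < V.card := by exact_mod_cast hV.card_pos
  have h1 : (2 : ℝ) ^ n * ∑ t ∈ V, (∑ x ∈ V, F x * F (x + t)) ^ 2
      ≤ 2 ^ n * ((ε * V.card) ^ 2 * V.card) := by
    rw [← parseval]
    simp_rw [← hV.sq_sum_walsh]
    calc ∑ r : Vec n, ((∑ x ∈ V, F x * walsh r x) ^ 2) ^ 2
        ≤ ∑ r : Vec n, (ε * V.card) ^ 2 * (∑ x ∈ V, F x * walsh r x) ^ 2 := by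
          refine Finset.sum_le_sum fun r _ => ?_
          rw [sq ((∑ x ∈ V, F x * walsh r x) ^ 2)]
          refine mul_le_mul_of_nonneg_right ?_ (sq_nonneg _)
          have := hε r
          rw [Finset.expect_eq_sum_div_card, abs_div, Nat.abs_cast, div_le_iff₀ hN] at this
          exact sq_le_sq' (by linarith [neg_abs_le (∑ x ∈ V, F x * walsh r x)])
            ((le_abs_self _).trans this)
      _ = 2 ^ n * ((ε * V.card) ^ 2 * ∑ x ∈ V, F x ^ 2) := by
          rw [← Finset.mul_sum, parseval]; ring
      _ ≤ _ := by
          gcongr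
          calc ∑ x ∈ V, F x ^ 2 ≤ ∑ x ∈ V, (1 : ℝ) :=
                Finset.sum_le_sum fun x _ => (sq_le_one_iff_abs_le_one _).2 (hF x)
            _ = V.card := by simp
  have h2 := le_of_mul_le_mul_left h1 (by positivity)
  simp_rw [Finset.expect_eq_sum_div_card, div_pow]
  rw [← Finset.sum_div, div_div, div_le_iff₀ (by positivity)]
  linarith [h2]

/-- The normalized count of the pattern `(x, y, x + y)` shifted by a common vector. -/
lemma expect_shifted_triple (hV : IsSub V) (f g h : Vec n → ℝ) :
    𝔼 x ∈ V, 𝔼 y ∈ V, 𝔼 u ∈ V, f (x + u) * g (y + u) * h (x + y + u)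
      = (𝔼 x ∈ V, f x) * (𝔼 x ∈ V, g x) * (𝔼 x ∈ V, h x) := by
  calc 𝔼 x ∈ V, 𝔼 y ∈ V, 𝔼 u ∈ V, f (x + u) * g (y + u) * h (x + y + u)
      = 𝔼 u ∈ V, 𝔼 x ∈ V, 𝔼 y ∈ V, f (x + u) * g (y + u) * h ((x + u) + (y + u) + u) := by
        rw [Finset.expect_congr rfl fun x _ => Finset.expect_comm _ _ _, Finset.expect_comm]
        refine Finset.expect_congr rfl fun u _ => Finset.expect_congr rfl fun x _ =>
          Finset.expect_congr rfl fun y _ => ?_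
        have : (x + u) + (y + u) + u = x + y + u := by
          rw [add_add_add_comm, vec_add_self, add_zero]
        rw [this]
    _ = 𝔼 u ∈ V, 𝔼 x ∈ V, 𝔼 y ∈ V, f x * g y * h (x + y + u) := by
        refine Finset.expect_congr rfl fun u hu => ?_
        rw [hV.expect_shift hu fun x => 𝔼 y ∈ V, f x * g (y + u) * h (x + (y + u) + u)]
        exact Finset.expect_congr rfl fun x _ =>
          hV.expect_shift hu fun y => f x * g y * h (x + y + u)
    _ = 𝔼 x ∈ V, 𝔼 y ∈ V, f x * g y * 𝔼 u ∈ V, h u := by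
        rw [Finset.expect_comm]
        refine Finset.expect_congr rfl fun x hx => ?_
        rw [Finset.expect_comm]
        refine Finset.expect_congr rfl fun y hy => ?_
        rw [← Finset.mul_expect, hV.expect_shift' (hV.add_mem x hx y hy)]
    _ = _ := by
        simp_rw [← Finset.expect_mul, ← Finset.mul_expect]
        rw [← Finset.expect_mul]

end IsSub

lemma expect_abs_le_of_expect_sq_le {ι : Type*} {s : Finset ι} (hs : s.Nonempty) (a : ι → ℝ)
    {τ : ℝ} (hτ : 0 < τ) (h : 𝔼 i ∈ s, a i ^ 2 ≤ τ ^ 2) : 𝔼 i ∈ s, |a i| ≤ τ := by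
  have h1 : 𝔼 i ∈ s, (2 * τ * |a i|) ≤ 𝔼 i ∈ s, (a i ^ 2 + τ ^ 2) :=
    Finset.expect_le_expect fun i _ => by
      nlinarith [sq_nonneg (|a i| - τ), sq_abs (a i)]
  rw [← Finset.mul_expect, Finset.expect_add_distrib, Finset.expect_const hs] at h1
  nlinarith

/-- The fraction of directions `u ∈ V` extending `(x, y)` to the pattern
`f (x + u), g (y + u), h (x + y + u)`. -/
noncomputable def extensionDensity {n : ℕ} (V : Finset (Vec n)) (f g h : Vec n → ℝ)
    (x y : Vec n) : ℝ :=
  𝔼 u ∈ V, f (x + u) * g (y + u) * h (x + y + u)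

/-- `F` has only small Walsh coefficients on `V` once its mean is removed. -/
def IsUniformOn {n : ℕ} (V : Finset (Vec n)) (ε : ℝ) (F : Vec n → ℝ) : Prop :=
  ∀ r, |𝔼 x ∈ V, (F x - 𝔼 y ∈ V, F y) * walsh r x| ≤ ε

namespace IsSub

variable {n : ℕ} {V : Finset (Vec n)}

lemma nonempty (hV : IsSub V) : V.Nonempty := ⟨0, hV.zero_mem⟩

lemma expect_mem_Icc (hV : IsSub V) {F : Vec n → ℝ} (hF : ∀ x, F x ∈ Set.Icc (0 : ℝ) 1) :
    𝔼 x ∈ V, F x ∈ Set.Icc (0 : ℝ) 1 :=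
  ⟨Finset.expect_nonneg fun x _ => (hF x).1, Finset.expect_le hV.nonempty fun x _ => (hF x).2⟩

lemma expect_abs_autocorrelation_sub_le (hV : IsSub V) {F : Vec n → ℝ}
    (hF : ∀ x, F x ∈ Set.Icc (0 : ℝ) 1) {ε : ℝ} (hε : 0 < ε) (hu : IsUniformOn V ε F) :
    𝔼 t ∈ V, |𝔼 x ∈ V, F x * F (x + t) - (𝔼 x ∈ V, F x) ^ 2| ≤ ε := by
  refine expect_abs_le_of_expect_sq_le hV.nonempty _ hε ?_
  have hm := hV.expect_mem_Icc hF
  refine le_trans (le_of_eq ?_)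
    (hV.expect_sq_autocorrelation_le (fun x => F x - 𝔼 y ∈ V, F y) (fun x => ?_) hu)
  · refine Finset.expect_congr rfl fun t ht => ?_
    congr 1
    set δ := 𝔼 y ∈ V, F y
    have h1 : 𝔼 x ∈ V, F (x + t) = δ := hV.expect_shift ht F
    have h2 : 𝔼 x ∈ V, (F x - δ) * (F (x + t) - δ)
        = 𝔼 x ∈ V, (F x * F (x + t) - δ * F x - δ * F (x + t) + δ ^ 2) :=
      Finset.expect_congr rfl fun x _ => by ring
    rw [h2, Finset.expect_add_distrib, Finset.expect_sub_distrib, Finset.expect_sub_distrib,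
      ← Finset.mul_expect, ← Finset.mul_expect, h1, Finset.expect_const hV.nonempty]
    ring
  · rw [abs_le]
    constructor <;> linarith [(hF x).1, (hF x).2, hm.1, hm.2]

/-- The second moment of `extensionDensity` is a correlation of autocorrelations. -/
lemma expect_extensionDensity_sq (hV : IsSub V) (f g h : Vec n → ℝ) :
    𝔼 x ∈ V, 𝔼 y ∈ V, extensionDensity V f g h x y ^ 2
      = 𝔼 t ∈ V, (𝔼 x ∈ V, f x * f (x + t)) * (𝔼 x ∈ V, g x * g (x + t))
          * (𝔼 x ∈ V, h x * h (x + t)) := by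
  have h1 (x y : Vec n) : extensionDensity V f g h x y ^ 2
      = 𝔼 t ∈ V, 𝔼 u ∈ V, (f (x + u) * f (x + u + t)) * (g (y + u) * g (y + u + t))
          * (h (x + y + u) * h (x + y + u + t)) := by
    rw [Finset.expect_comm, sq, extensionDensity, Finset.expect_mul_expect]
    refine Finset.expect_congr rfl fun u hu => ?_
    rw [← hV.expect_shift' hu]
    refine Finset.expect_congr rfl fun t _ => ?_
    simp only [← add_assoc]
    ring
  simp_rw [h1]
  rw [Finset.expect_congr rfl fun x _ => Finset.expect_comm _ _ _, Finset.expect_comm]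
  refine Finset.expect_congr rfl fun t _ => ?_
  exact hV.expect_shifted_triple (fun x => f x * f (x + t)) (fun x => g x * g (x + t))
    (fun x => h x * h (x + t))

/-- If `f` and `g` are uniform on `V`, the `extensionDensity` concentrates around its mean. -/
lemma expect_abs_extensionDensity_sub_le (hV : IsSub V) {f g h : Vec n → ℝ}
    (hf : ∀ x, f x ∈ Set.Icc (0 : ℝ) 1) (hg : ∀ x, g x ∈ Set.Icc (0 : ℝ) 1)
    (hh : ∀ x, h x ∈ Set.Icc (0 : ℝ) 1) {τ : ℝ} (hτ : 0 < τ)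
    (huf : IsUniformOn V (τ ^ 2 / 2) f) (hug : IsUniformOn V (τ ^ 2 / 2) g) :
    𝔼 x ∈ V, 𝔼 y ∈ V, |extensionDensity V f g h x y
      - (𝔼 x ∈ V, f x) * (𝔼 x ∈ V, g x) * (𝔼 x ∈ V, h x)| ≤ τ := by
  rw [← Finset.expect_product']
  refine expect_abs_le_of_expect_sq_le (hV.nonempty.product hV.nonempty) _ hτ ?_
  rw [Finset.expect_product' (f := fun x y => (extensionDensity V f g h x y
      - (𝔼 x ∈ V, f x) * (𝔼 x ∈ V, g x) * (𝔼 x ∈ V, h x)) ^ 2)]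
  have haf := hV.expect_abs_autocorrelation_sub_le hf (by positivity) huf
  have hag := hV.expect_abs_autocorrelation_sub_le hg (by positivity) hug
  have hmf := hV.expect_mem_Icc hf
  have hmh : 𝔼 t ∈ V, 𝔼 x ∈ V, h x * h (x + t) = (𝔼 x ∈ V, h x) ^ 2 := by
    rw [Finset.expect_comm, sq, Finset.expect_mul_expect]
    refine Finset.expect_congr rfl fun x hx => ?_
    exact hV.expect_shift' hx fun t => h x * h t
  have hmean := hV.expect_shifted_triple f g h
  have hsq := hV.expect_extensionDensity_sq f g h
  set a := 𝔼 x ∈ V, f x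
  set b := 𝔼 x ∈ V, g x
  set c := 𝔼 x ∈ V, h x
  have hvar : 𝔼 x ∈ V, 𝔼 y ∈ V, (extensionDensity V f g h x y - a * b * c) ^ 2
      = 𝔼 x ∈ V, 𝔼 y ∈ V, extensionDensity V f g h x y ^ 2 - (a * b * c) ^ 2 := by
    simp_rw [sub_sq, Finset.expect_add_distrib, Finset.expect_sub_distrib,
      Finset.expect_const hV.nonempty, ← Finset.expect_mul, ← Finset.mul_expect]
    change _ - 2 * (𝔼 x ∈ V, 𝔼 y ∈ V, 𝔼 u ∈ V, f (x + u) * g (y + u) * h (x + y + u)) * _ + _ = _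
    rw [hmean]
    ring
  rw [hvar, hsq]
  have hprod (F : Vec n → ℝ) (hF : ∀ x, F x ∈ Set.Icc (0 : ℝ) 1) (t : Vec n) :
      𝔼 x ∈ V, F x * F (x + t) ∈ Set.Icc (0 : ℝ) 1 :=
    hV.expect_mem_Icc fun x =>
      ⟨mul_nonneg (hF x).1 (hF _).1, mul_le_one₀ (hF x).2 (hF _).1 (hF _).2⟩
  have hpt : 𝔼 t ∈ V, (𝔼 x ∈ V, f x * f (x + t)) * (𝔼 x ∈ V, g x * g (x + t))
          * (𝔼 x ∈ V, h x * h (x + t))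
      ≤ 𝔼 t ∈ V, (|𝔼 x ∈ V, f x * f (x + t) - a ^ 2| + |𝔼 x ∈ V, g x * g (x + t) - b ^ 2|
          + (a * b) ^ 2 * 𝔼 x ∈ V, h x * h (x + t)) := by
    refine Finset.expect_le_expect fun t _ => ?_
    have hA := hprod f hf t
    have hB := hprod g hg t
    have hC := hprod h hh t
    set A := 𝔼 x ∈ V, f x * f (x + t)
    set B := 𝔼 x ∈ V, g x * g (x + t)
    set C := 𝔼 x ∈ V, h x * h (x + t)
    have ha2 : a ^ 2 ≤ 1 := pow_le_one₀ hmf.1 hmf.2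
    have e : A * B * C = (A - a ^ 2) * (B * C) + (B - b ^ 2) * (a ^ 2 * C) + (a * b) ^ 2 * C := by
      ring
    have key (z w : ℝ) (h0 : 0 ≤ w) (h1 : w ≤ 1) : z * w ≤ |z| :=
      (mul_le_mul_of_nonneg_right (le_abs_self z) h0).trans
        (mul_le_of_le_one_right (abs_nonneg z) h1)
    rw [e]
    have k1 := key (A - a ^ 2) (B * C) (mul_nonneg hB.1 hC.1) (mul_le_one₀ hB.2 hC.1 hC.2)
    have k2 := key (B - b ^ 2) (a ^ 2 * C) (mul_nonneg (sq_nonneg a) hC.1)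
      (mul_le_one₀ ha2 hC.1 hC.2)
    linarith
  rw [Finset.expect_add_distrib, Finset.expect_add_distrib, ← Finset.mul_expect, hmh] at hpt
  have : (a * b * c) ^ 2 = (a * b) ^ 2 * c ^ 2 := by ring
  linarith

end IsSub

/-- Indicator functions `f, g, h` of three events and a loss function `ℓ` such that each
pattern `{x, x + u} × {y, y + u}` supported by the events, with `u ∉ B`, carries a loss of at
least `1 / 4`. -/
structure LossSystem {n : ℕ} (B : Finset (Vec n)) (f g h : Vec n → ℝ)
    (ℓ : Vec n → Vec n → ℝ) : Prop where
  f_eq : ∀ x, f x = 0 ∨ f x = 1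
  g_eq : ∀ x, g x = 0 ∨ g x = 1
  h_eq : ∀ x, h x = 0 ∨ h x = 1
  loss_nonneg : ∀ x y, 0 ≤ ℓ x y
  loss_le_one : ∀ x y, ℓ x y ≤ 1
  cover : ∀ x y u, u ∉ B → f x = 1 → f (x + u) = 1 → g y = 1 → g (y + u) = 1 →
    h (x + y) = 1 → h (x + y + u) = 1 →
    1 ≤ 4 * (ℓ x y + ℓ (x + u) y + ℓ x (y + u) + ℓ (x + u) (y + u))

/-- The indicator that the pattern `{x, x + u} × {y, y + u}` is supported by the events. -/
def pattern {n : ℕ} (f g h : Vec n → ℝ) (x y u : Vec n) : ℝ :=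
  f x * f (x + u) * (g y * g (y + u)) * (h (x + y) * h (x + y + u))

lemma mem_Icc_of_eq {a : ℝ} (h : a = 0 ∨ a = 1) : a ∈ Set.Icc (0 : ℝ) 1 := by
  rcases h with rfl | rfl <;> simp

namespace LossSystem

variable {n : ℕ} {B V : Finset (Vec n)} {f g h : Vec n → ℝ} {ℓ : Vec n → Vec n → ℝ}

lemma pattern_le (H : LossSystem B f g h ℓ) (x y u : Vec n) :
    pattern f g h x y u ≤ 4 * (pattern f g h x y u * ℓ x y + pattern f g h x y u * ℓ (x + u) y
      + pattern f g h x y u * ℓ x (y + u) + pattern f g h x y u * ℓ (x + u) (y + u))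
      + (if u ∈ B then 1 else 0) := by
  unfold pattern
  have n1 := H.loss_nonneg x y
  have n2 := H.loss_nonneg (x + u) y
  have n3 := H.loss_nonneg x (y + u)
  have n4 := H.loss_nonneg (x + u) (y + u)
  have hc := H.cover x y u
  have hi : (0 : ℝ) ≤ if u ∈ B then 1 else 0 := by split_ifs <;> norm_num
  rcases H.f_eq x with h1 | h1 <;> rw [h1] at hc ⊢
  · simpa using hi
  rcases H.f_eq (x + u) with h2 | h2 <;> rw [h2] at hc ⊢
  · simpa using hi
  rcases H.g_eq y with h3 | h3 <;> rw [h3] at hc ⊢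
  · simpa using hi
  rcases H.g_eq (y + u) with h4 | h4 <;> rw [h4] at hc ⊢
  · simpa using hi
  rcases H.h_eq (x + y) with h5 | h5 <;> rw [h5] at hc ⊢
  · simpa using hi
  rcases H.h_eq (x + y + u) with h6 | h6 <;> rw [h6] at hc ⊢
  · simpa using hi
  by_cases hu : u ∈ B
  · simp only [hu, if_true]
    linarith
  · have := hc hu rfl rfl rfl rfl rfl rfl
    simp only [hu, if_false]
    linarith

lemma pattern_flip_left (f g h : Vec n → ℝ) (x y u : Vec n) :
    pattern f g h (x + u) y u = pattern f g h x y u := by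
  have e1 : x + u + u = x := by rw [add_assoc, vec_add_self, add_zero]
  have e2 : x + u + y = x + y + u := by abel
  have e3 : x + u + y + u = x + y := by rw [e2, add_assoc, vec_add_self, add_zero]
  unfold pattern
  rw [e3, e2, e1]
  ring

lemma pattern_flip_right (f g h : Vec n → ℝ) (x y u : Vec n) :
    pattern f g h x (y + u) u = pattern f g h x y u := by
  have e1 : y + u + u = y := by rw [add_assoc, vec_add_self, add_zero]
  have e2 : x + (y + u) = x + y + u := by abel
  have e3 : x + y + u + u = x + y := by rw [add_assoc, vec_add_self, add_zero]
  unfold pattern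
  rw [e2, e3, e1]
  ring

/-- Averaging the local contradiction over all patterns in `V`. -/
lemma expect_pattern_le (H : LossSystem B f g h ℓ) (hV : IsSub V) :
    𝔼 x ∈ V, 𝔼 y ∈ V, 𝔼 u ∈ V, pattern f g h x y u
      ≤ 16 * 𝔼 x ∈ V, 𝔼 y ∈ V, 𝔼 u ∈ V, pattern f g h x y u * ℓ x y
        + 𝔼 u ∈ V, (if u ∈ B then (1 : ℝ) else 0) := by
  have hcomm (Q : Vec n → Vec n → Vec n → ℝ) :
      𝔼 x ∈ V, 𝔼 y ∈ V, 𝔼 u ∈ V, Q x y u = 𝔼 u ∈ V, 𝔼 x ∈ V, 𝔼 y ∈ V, Q x y u := by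
    rw [Finset.expect_congr rfl fun x _ => Finset.expect_comm _ _ _, Finset.expect_comm]
  rw [hcomm fun x y u => pattern f g h x y u, hcomm fun x y u => pattern f g h x y u * ℓ x y,
    Finset.mul_expect, ← Finset.expect_add_distrib]
  refine Finset.expect_le_expect fun u hu => ?_
  set p := pattern f g h
  have s1 (Q : Vec n → Vec n → ℝ) :
      𝔼 x ∈ V, 𝔼 y ∈ V, Q (x + u) y = 𝔼 x ∈ V, 𝔼 y ∈ V, Q x y :=
    hV.expect_shift hu fun x => 𝔼 y ∈ V, Q x y
  have s2 (Q : Vec n → Vec n → ℝ) :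
      𝔼 x ∈ V, 𝔼 y ∈ V, Q x (y + u) = 𝔼 x ∈ V, 𝔼 y ∈ V, Q x y :=
    Finset.expect_congr rfl fun x _ => hV.expect_shift hu fun y => Q x y
  have e1 : 𝔼 x ∈ V, 𝔼 y ∈ V, p x y u * ℓ (x + u) y = 𝔼 x ∈ V, 𝔼 y ∈ V, p x y u * ℓ x y := by
    rw [← s1 fun x y => p x y u * ℓ x y]
    simp only [p, pattern_flip_left]
  have e2 : 𝔼 x ∈ V, 𝔼 y ∈ V, p x y u * ℓ x (y + u) = 𝔼 x ∈ V, 𝔼 y ∈ V, p x y u * ℓ x y := by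
    rw [← s2 fun x y => p x y u * ℓ x y]
    simp only [p, pattern_flip_right]
  have e3 : 𝔼 x ∈ V, 𝔼 y ∈ V, p x y u * ℓ (x + u) (y + u)
      = 𝔼 x ∈ V, 𝔼 y ∈ V, p x y u * ℓ x y := by
    rw [← e2, ← s1 fun x y => p x y u * ℓ x (y + u)]
    simp only [p, pattern_flip_left]
  calc 𝔼 x ∈ V, 𝔼 y ∈ V, p x y u
      ≤ 𝔼 x ∈ V, 𝔼 y ∈ V, (4 * (p x y u * ℓ x y + p x y u * ℓ (x + u) y
          + p x y u * ℓ x (y + u) + p x y u * ℓ (x + u) (y + u)) + (if u ∈ B then 1 else 0)) :=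
        Finset.expect_le_expect fun x _ => Finset.expect_le_expect fun y _ => H.pattern_le x y u
    _ = _ := by
        simp_rw [Finset.expect_add_distrib, ← Finset.mul_expect, Finset.expect_add_distrib,
          Finset.expect_const hV.nonempty]
        rw [e1, e2, e3]
        ring

/-- On a subspace where `f` and `g` are uniform, the average loss is a constant fraction of the
density of the event. -/
lemma le_expect_loss_of_uniform (H : LossSystem B f g h ℓ) (hV : IsSub V) {τ β σ : ℝ}
    (hτ : 0 < τ) (hσ : 0 < σ) (hβ : 𝔼 u ∈ V, (if u ∈ B then (1 : ℝ) else 0) ≤ β)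
    (huf : IsUniformOn V (τ ^ 2 / 2) f) (hug : IsUniformOn V (τ ^ 2 / 2) g) :
    (𝔼 x ∈ V, 𝔼 y ∈ V, f x * g y * h (x + y)) / 16 - σ / 16 - (17 * τ + β) / (16 * σ ^ 3)
      ≤ 𝔼 x ∈ V, 𝔼 y ∈ V, ℓ x y := by
  have hf x := mem_Icc_of_eq (H.f_eq x)
  have hg x := mem_Icc_of_eq (H.g_eq x)
  have hh x := mem_Icc_of_eq (H.h_eq x)
  have hdev := hV.expect_abs_extensionDensity_sub_le hf hg hh hτ huf hug
  have hpat := (H.expect_pattern_le hV).trans (add_le_add_right hβ _)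
  have hF (x y : Vec n) : f x * g y * h (x + y) ∈ Set.Icc (0 : ℝ) 1 :=
    ⟨mul_nonneg (mul_nonneg (hf x).1 (hg y).1) (hh _).1,
      mul_le_one₀ (mul_le_one₀ (hf x).2 (hg y).1 (hg y).2) (hh _).1 (hh _).2⟩
  have hsplit (x y u : Vec n) : pattern f g h x y u
      = f x * g y * h (x + y) * (f (x + u) * g (y + u) * h (x + y + u)) := by
    unfold pattern; ring
  have hK (x y : Vec n) : 𝔼 u ∈ V, pattern f g h x y u
      = f x * g y * h (x + y) * extensionDensity V f g h x y := by
    simp_rw [hsplit, ← Finset.mul_expect, extensionDensity]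
  simp_rw [← Finset.expect_mul, hK] at hpat
  have hsf : 𝔼 x ∈ V, 𝔼 y ∈ V, f x * g y * h (x + y) ≤ 𝔼 x ∈ V, f x := by
    refine Finset.expect_le_expect fun x _ => Finset.expect_le hV.nonempty fun y _ => ?_
    rw [mul_assoc]
    exact mul_le_of_le_one_right (hf x).1 (mul_le_one₀ (hg y).2 (hh _).1 (hh _).2)
  have hsg : 𝔼 x ∈ V, 𝔼 y ∈ V, f x * g y * h (x + y) ≤ 𝔼 x ∈ V, g x := by
    rw [Finset.expect_comm]
    refine Finset.expect_le_expect fun x _ => Finset.expect_le hV.nonempty fun y _ => ?_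
    rw [mul_comm (f y), mul_assoc]
    exact mul_le_of_le_one_right (hg x).1 (mul_le_one₀ (hf y).2 (hh _).1 (hh _).2)
  have hsh : 𝔼 x ∈ V, 𝔼 y ∈ V, f x * g y * h (x + y) ≤ 𝔼 x ∈ V, h x := by
    refine Finset.expect_le hV.nonempty fun x hx => ?_
    rw [← hV.expect_shift' hx h]
    refine Finset.expect_le_expect fun y _ => ?_
    exact mul_le_of_le_one_left (hh _).1 (mul_le_one₀ (hf x).2 (hg y).1 (hg y).2)
  have hℓ : 0 ≤ 𝔼 x ∈ V, 𝔼 y ∈ V, ℓ x y :=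
    Finset.expect_nonneg fun x _ => Finset.expect_nonneg fun y _ => H.loss_nonneg x y
  have hβ0 : 0 ≤ β := le_trans
    (Finset.expect_nonneg fun u _ => by split_ifs <;> norm_num) hβ
  set a := 𝔼 x ∈ V, f x
  set b := 𝔼 x ∈ V, g x
  set c := 𝔼 x ∈ V, h x
  set κ := a * b * c with hκ
  set Λ := 𝔼 x ∈ V, 𝔼 y ∈ V, ℓ x y
  set s := 𝔼 x ∈ V, 𝔼 y ∈ V, f x * g y * h (x + y)
  set K := extensionDensity V f g h
  have lower : κ * s - τ ≤ 𝔼 x ∈ V, 𝔼 y ∈ V, f x * g y * h (x + y) * K x y := by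
    have : 𝔼 x ∈ V, 𝔼 y ∈ V, (κ * (f x * g y * h (x + y)) - |K x y - κ|)
        ≤ 𝔼 x ∈ V, 𝔼 y ∈ V, f x * g y * h (x + y) * K x y := by
      refine Finset.expect_le_expect fun x _ => Finset.expect_le_expect fun y _ => ?_
      have h1 := hF x y
      set w := f x * g y * h (x + y)
      have h2 := mul_le_mul_of_nonneg_left (neg_abs_le (K x y - κ)) h1.1
      have h3 := mul_le_of_le_one_left (abs_nonneg (K x y - κ)) h1.2
      linarith
    simp_rw [Finset.expect_sub_distrib, ← Finset.mul_expect] at this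
    linarith
  have upper : 𝔼 x ∈ V, 𝔼 y ∈ V, f x * g y * h (x + y) * K x y * ℓ x y ≤ κ * Λ + τ := by
    have hκ0 : 0 ≤ κ := mul_nonneg (mul_nonneg (hV.expect_mem_Icc hf).1 (hV.expect_mem_Icc hg).1)
      (hV.expect_mem_Icc hh).1
    have : 𝔼 x ∈ V, 𝔼 y ∈ V, f x * g y * h (x + y) * K x y * ℓ x y
        ≤ 𝔼 x ∈ V, 𝔼 y ∈ V, (κ * ℓ x y + |K x y - κ|) := by
      refine Finset.expect_le_expect fun x _ => Finset.expect_le_expect fun y _ => ?_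
      have h1 := hF x y
      have l0 := H.loss_nonneg x y
      have l1 := H.loss_le_one x y
      set w := f x * g y * h (x + y)
      have hw0 : 0 ≤ w * ℓ x y := mul_nonneg h1.1 l0
      have hw1 : w * ℓ x y ≤ ℓ x y := mul_le_of_le_one_left l0 h1.2
      nlinarith [le_abs_self (K x y - κ), abs_nonneg (K x y - κ),
        mul_le_mul_of_nonneg_left hw1 hκ0]
    simp_rw [Finset.expect_add_distrib, ← Finset.mul_expect] at this
    linarith
  have main : κ * s ≤ 16 * κ * Λ + (17 * τ + β) := by linarith
  have hE : 0 ≤ (17 * τ + β) / (16 * σ ^ 3) := by positivity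
  rcases le_or_gt s σ with hsσ | hsσ
  · linarith
  have hκσ : σ ^ 3 ≤ κ := by
    have e : σ ^ 3 = σ * σ * σ := by ring
    rw [e, hκ]
    exact mul_le_mul (mul_le_mul (by linarith) (by linarith) hσ.le (by linarith)) (by linarith)
      hσ.le (mul_nonneg (by linarith) (by linarith))
  have hκpos : 0 < κ := lt_of_lt_of_le (by positivity) hκσ
  have h2 : s ≤ 16 * Λ + (17 * τ + β) / κ := by
    rw [← sub_le_iff_le_add', le_div_iff₀ hκpos]
    linarith
  have h3 : (17 * τ + β) / κ ≤ (17 * τ + β) / σ ^ 3 := by gcongr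
  have h4 : (17 * τ + β) / (16 * σ ^ 3) = (17 * τ + β) / σ ^ 3 / 16 := by
    rw [div_div, mul_comm (16 : ℝ)]
  linarith

end LossSystem

/-- The points of `V` on which the character `walsh r` is trivial. -/
noncomputable def walshKernel {n : ℕ} (V : Finset (Vec n)) (r : Vec n) : Finset (Vec n) :=
  {x ∈ V | walsh r x = 1}

lemma mem_walshKernel {n : ℕ} {V : Finset (Vec n)} {r x : Vec n} :
    x ∈ walshKernel V r ↔ x ∈ V ∧ walsh r x = 1 :=
  Finset.mem_filter

namespace IsSub

variable {n : ℕ} {V : Finset (Vec n)} {r w : Vec n}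

lemma walshKernel (hV : IsSub V) (r : Vec n) : IsSub (walshKernel V r) where
  zero_mem := mem_walshKernel.2 ⟨hV.zero_mem, by simp [walsh, bitSign]⟩
  add_mem x hx y hy := by
    rw [mem_walshKernel] at *
    exact ⟨hV.add_mem x hx.1 y hy.1, by rw [walsh_add, hx.2, hy.2, one_mul]⟩

lemma sum_eq_walshKernel (hV : IsSub V) (hw : w ∈ V) (hr : walsh r w = -1) (F : Vec n → ℝ) :
    ∑ x ∈ V, F x
      = ∑ x ∈ _root_.walshKernel V r, F x + ∑ x ∈ _root_.walshKernel V r, F (w + x) := by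
  classical
  rw [← Finset.sum_filter_add_sum_filter_not V (· ∈ _root_.walshKernel V r)]
  congr 1
  · refine Finset.sum_congr ?_ fun _ _ => rfl
    ext x
    simp only [Finset.mem_filter, mem_walshKernel]
    tauto
  · refine (Finset.sum_equiv (Equiv.addLeft w) (fun x => ?_) fun x _ => rfl).symm
    have h1 : w + x ∈ V ↔ x ∈ V := by rw [add_comm, hV.add_mem_iff hw]
    simp only [Finset.mem_filter, mem_walshKernel, Equiv.coe_addLeft, h1, walsh_add, hr]
    refine and_congr_right fun hx => ?_
    rcases walsh_eq_one_or r x with h | h <;> rw [h] <;> norm_num [hx]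

lemma card_eq_walshKernel (hV : IsSub V) (hw : w ∈ V) (hr : walsh r w = -1) :
    V.card = 2 * (_root_.walshKernel V r).card := by
  have h := hV.sum_eq_walshKernel hw hr fun _ => 1
  simp only [Finset.sum_const, nsmul_eq_mul, mul_one] at h
  have h' : V.card = (_root_.walshKernel V r).card + (_root_.walshKernel V r).card := by
    exact_mod_cast h
  lia

lemma expect_eq_walshKernel (hV : IsSub V) (hw : w ∈ V) (hr : walsh r w = -1)
    (F : Vec n → ℝ) :
    𝔼 x ∈ V, F x = (𝔼 x ∈ _root_.walshKernel V r, F (0 + x)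
      + 𝔼 x ∈ _root_.walshKernel V r, F (w + x)) / 2 := by
  simp only [zero_add, Finset.expect_eq_sum_div_card]
  rw [hV.sum_eq_walshKernel hw hr, hV.card_eq_walshKernel hw hr]
  push_cast
  rw [← add_div, div_div, mul_comm]

/-- A subspace on which `F` is not uniform has an index-two subspace on whose two cosets the
densities of `F` differ. -/
lemma exists_energy_increment (hV : IsSub V) {F : Vec n → ℝ} {ε : ℝ} (hε : 0 < ε)
    (hF : ¬ IsUniformOn V ε F) :
    ∃ r, ∃ w ∈ V, walsh r w = -1 ∧ (𝔼 x ∈ V, F x) ^ 2 + ε ^ 2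
      ≤ ((𝔼 x ∈ _root_.walshKernel V r, F (0 + x)) ^ 2
        + (𝔼 x ∈ _root_.walshKernel V r, F (w + x)) ^ 2) / 2 := by
  unfold IsUniformOn at hF
  push Not at hF
  obtain ⟨r, hr⟩ := hF
  have hex : ∃ w ∈ V, walsh r w = -1 := by
    by_contra! hcon
    have h1 : 𝔼 x ∈ V, (F x - 𝔼 y ∈ V, F y) * walsh r x = 0 := by
      have : 𝔼 x ∈ V, (F x - 𝔼 y ∈ V, F y) * walsh r x = 𝔼 x ∈ V, (F x - 𝔼 y ∈ V, F y) :=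
        Finset.expect_congr rfl fun x hx => by
          rw [(walsh_eq_one_or r x).resolve_right (hcon x hx), mul_one]
      rw [this, Finset.expect_sub_distrib, Finset.expect_const hV.nonempty, sub_self]
    rw [h1, abs_zero] at hr
    linarith
  obtain ⟨w, hw, hrw⟩ := hex
  refine ⟨r, w, hw, hrw, ?_⟩
  have hne := (hV.walshKernel r).nonempty
  have e1 := hV.expect_eq_walshKernel hw hrw F
  have e2 := hV.expect_eq_walshKernel hw hrw fun x => (F x - 𝔼 y ∈ V, F y) * walsh r x
  have k1 : 𝔼 x ∈ _root_.walshKernel V r, (F (0 + x) - 𝔼 y ∈ V, F y) * walsh r (0 + x)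
      = 𝔼 x ∈ _root_.walshKernel V r, F (0 + x) - 𝔼 y ∈ V, F y := by
    rw [← Finset.expect_const hne (𝔼 y ∈ V, F y), ← Finset.expect_sub_distrib]
    refine Finset.expect_congr rfl fun x hx => ?_
    rw [Finset.expect_const hne, zero_add, (mem_walshKernel.1 hx).2, mul_one]
  have k2 : 𝔼 x ∈ _root_.walshKernel V r, (F (w + x) - 𝔼 y ∈ V, F y) * walsh r (w + x)
      = 𝔼 y ∈ V, F y - 𝔼 x ∈ _root_.walshKernel V r, F (w + x) := by
    rw [← Finset.expect_const hne (𝔼 y ∈ V, F y), ← Finset.expect_sub_distrib]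
    refine Finset.expect_congr rfl fun x hx => ?_
    rw [Finset.expect_const hne, walsh_add, (mem_walshKernel.1 hx).2, hrw]
    ring
  rw [k1, k2] at e2
  rw [e2] at hr
  set p := 𝔼 x ∈ _root_.walshKernel V r, F (0 + x)
  set q := 𝔼 x ∈ _root_.walshKernel V r, F (w + x)
  set δ := 𝔼 x ∈ V, F x
  have h3 : (p - δ + (δ - q)) / 2 = (p - q) / 2 := by ring
  rw [h3] at hr
  have h4 : ε ^ 2 ≤ ((p - q) / 2) ^ 2 := by
    rw [← sq_abs ((p - q) / 2)]
    gcongr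
  rw [e1]
  linarith [h4, show ((p + q) / 2) ^ 2 + ((p - q) / 2) ^ 2 = (p ^ 2 + q ^ 2) / 2 by ring]

lemma expect_le_card_div (hV : IsSub V) {B : Finset (Vec n)} {j D : ℕ}
    (hcard : 2 ^ n ≤ V.card * 2 ^ j) (hj : j ≤ D) :
    𝔼 u ∈ V, (if u ∈ B then (1 : ℝ) else 0) ≤ B.card * 2 ^ D / 2 ^ n := by
  classical
  have hN : (0 : ℝ) < V.card := by exact_mod_cast hV.card_pos
  rw [Finset.expect_eq_sum_div_card, div_le_div_iff₀ hN (by positivity)]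
  have h1 : ∑ u ∈ V, (if u ∈ B then (1 : ℝ) else 0) ≤ B.card := by
    rw [← Finset.sum_filter]
    simp only [Finset.sum_const, nsmul_eq_mul, mul_one]
    exact_mod_cast Finset.card_le_card fun u hu => (Finset.mem_filter.1 hu).2
  have h2 : (2 : ℝ) ^ n ≤ V.card * 2 ^ j := by exact_mod_cast hcard
  have h3 : (2 : ℝ) ^ j ≤ 2 ^ D := pow_le_pow_right₀ (by norm_num) hj
  calc (∑ u ∈ V, (if u ∈ B then (1 : ℝ) else 0)) * 2 ^ n ≤ B.card * (V.card * 2 ^ D) :=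
        mul_le_mul h1 (h2.trans (by gcongr)) (by positivity) (by positivity)
    _ = _ := by ring

end IsSub

namespace LossSystem

variable {n : ℕ} {B V : Finset (Vec n)} {f g h : Vec n → ℝ} {ℓ : Vec n → Vec n → ℝ}

lemma translate (H : LossSystem B f g h ℓ) (a b : Vec n) :
    LossSystem B (fun x => f (a + x)) (fun y => g (b + y)) (fun z => h (a + b + z))
      (fun x y => ℓ (a + x) (b + y)) where
  f_eq x := H.f_eq _
  g_eq x := H.g_eq _
  h_eq x := H.h_eq _
  loss_nonneg x y := H.loss_nonneg _ _
  loss_le_one x y := H.loss_le_one _ _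
  cover x y u hu h1 h2 h3 h4 h5 h6 := by
    have := H.cover (a + x) (b + y) u hu h1 (by rwa [add_assoc]) h3 (by rwa [add_assoc])
      (by rwa [add_add_add_comm]) (by rwa [add_add_add_comm, add_assoc])
    simpa only [add_assoc] using this

/-- The energy increment argument: passing to index-two subspaces at most `D` times. -/
lemma le_expect_loss_on_subspace {τ β σ : ℝ} (hτ : 0 < τ) (hσ : 0 < σ) {D : ℕ} (hD : 0 < D)
    (hβ : (B.card : ℝ) * 2 ^ D / 2 ^ n ≤ β) (m : ℕ) :
    ∀ {j : ℕ} {V : Finset (Vec n)} {f g h : Vec n → ℝ} {ℓ : Vec n → Vec n → ℝ},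
      LossSystem B f g h ℓ → IsSub V → m + j = D → 2 ^ n ≤ V.card * 2 ^ j →
      (𝔼 x ∈ V, 𝔼 y ∈ V, f x * g y * h (x + y)) / 16 - σ / 16 - (17 * τ + β) / (16 * σ ^ 3)
        - ((2 - (𝔼 x ∈ V, f x) ^ 2 - (𝔼 x ∈ V, g x) ^ 2) / (τ ^ 2 / 2) ^ 2 + j) / D
        ≤ 𝔼 x ∈ V, 𝔼 y ∈ V, ℓ x y := by
  have hβ0 : 0 ≤ β := le_trans (by positivity) hβ
  have hD' : (0 : ℝ) < D := by exact_mod_cast hD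
  have hE : 0 ≤ (17 * τ + β) / (16 * σ ^ 3) := by positivity
  have hpos {V : Finset (Vec n)} {f g h : Vec n → ℝ} {ℓ : Vec n → Vec n → ℝ}
      (H : LossSystem B f g h ℓ) (hV : IsSub V) :
      0 ≤ (2 - (𝔼 x ∈ V, f x) ^ 2 - (𝔼 x ∈ V, g x) ^ 2) / (τ ^ 2 / 2) ^ 2 := by
    have hf := hV.expect_mem_Icc fun x => mem_Icc_of_eq (H.f_eq x)
    have hg := hV.expect_mem_Icc fun x => mem_Icc_of_eq (H.g_eq x)
    have h1 := pow_le_one₀ (n := 2) hf.1 hf.2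
    have h2 := pow_le_one₀ (n := 2) hg.1 hg.2
    exact div_nonneg (by linarith) (by positivity)
  induction m with
  | zero =>
    intro j V f g h ℓ H hV hj _
    have hjD : (j : ℝ) = D := by rw [← hj, zero_add]
    have h1 := hpos H hV
    have hΛ : 0 ≤ 𝔼 x ∈ V, 𝔼 y ∈ V, ℓ x y :=
      Finset.expect_nonneg fun x _ => Finset.expect_nonneg fun y _ => H.loss_nonneg x y
    have hs : 𝔼 x ∈ V, 𝔼 y ∈ V, f x * g y * h (x + y) ≤ 1 :=
      Finset.expect_le hV.nonempty fun x _ => Finset.expect_le hV.nonempty fun y _ => by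
        have hf := mem_Icc_of_eq (H.f_eq x)
        have hg := mem_Icc_of_eq (H.g_eq y)
        have hh := mem_Icc_of_eq (H.h_eq (x + y))
        exact mul_le_one₀ (mul_le_one₀ hf.2 hg.1 hg.2) hh.1 hh.2
    have h2 : 1 ≤ ((2 - (𝔼 x ∈ V, f x) ^ 2 - (𝔼 x ∈ V, g x) ^ 2) / (τ ^ 2 / 2) ^ 2 + j) / D := by
      rw [le_div_iff₀ hD']
      linarith
    linarith
  | succ m ih =>
    intro j V f g h ℓ H hV hj hcard
    by_cases hu : IsUniformOn V (τ ^ 2 / 2) f ∧ IsUniformOn V (τ ^ 2 / 2) g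
    · have h1 := H.le_expect_loss_of_uniform hV hτ hσ
        ((hV.expect_le_card_div hcard (by lia)).trans hβ) hu.1 hu.2
      have h2 : 0 ≤ ((2 - (𝔼 x ∈ V, f x) ^ 2 - (𝔼 x ∈ V, g x) ^ 2) / (τ ^ 2 / 2) ^ 2 + j) / D :=
        div_nonneg (add_nonneg (hpos H hV) (Nat.cast_nonneg j)) hD'.le
      linarith
    set ε := τ ^ 2 / 2 with hε
    have hε0 : 0 < ε := by positivity
    have hconv {r w : Vec n} (hw : w ∈ V) (hr : walsh r w = -1) (F : Vec n → ℝ) :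
        (𝔼 x ∈ V, F x) ^ 2 ≤ ((𝔼 x ∈ walshKernel V r, F (0 + x)) ^ 2
          + (𝔼 x ∈ walshKernel V r, F (w + x)) ^ 2) / 2 := by
      rw [hV.expect_eq_walshKernel hw hr F]
      nlinarith [sq_nonneg ((𝔼 x ∈ walshKernel V r, F (0 + x))
        - 𝔼 x ∈ walshKernel V r, F (w + x))]
    have hinc : ∃ r, ∃ w ∈ V, walsh r w = -1 ∧
        (𝔼 x ∈ V, f x) ^ 2 + (𝔼 x ∈ V, g x) ^ 2 + ε ^ 2
          ≤ ((𝔼 x ∈ walshKernel V r, f (0 + x)) ^ 2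
            + (𝔼 x ∈ walshKernel V r, f (w + x)) ^ 2) / 2
          + ((𝔼 x ∈ walshKernel V r, g (0 + x)) ^ 2
            + (𝔼 x ∈ walshKernel V r, g (w + x)) ^ 2) / 2 := by
      by_cases huf : IsUniformOn V ε f
      · obtain ⟨r, w, hw, hr, hle⟩ := hV.exists_energy_increment hε0 fun hug => hu ⟨huf, hug⟩
        exact ⟨r, w, hw, hr, by linarith [hconv hw hr f]⟩
      · obtain ⟨r, w, hw, hr, hle⟩ := hV.exists_energy_increment hε0 huf
        exact ⟨r, w, hw, hr, by linarith [hconv hw hr g]⟩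
    obtain ⟨r, w, hw, hr, hle⟩ := hinc
    have hcard' : 2 ^ n ≤ (walshKernel V r).card * 2 ^ (j + 1) := by
      rw [hV.card_eq_walshKernel hw hr] at hcard
      calc 2 ^ n ≤ _ := hcard
        _ = _ := by ring
    have sub (a b : Vec n) := ih (H.translate a b) (hV.walshKernel r) (by lia) hcard'
    have split (Q : Vec n → Vec n → ℝ) : 𝔼 x ∈ V, 𝔼 y ∈ V, Q x y
        = (𝔼 x ∈ walshKernel V r, 𝔼 y ∈ walshKernel V r, Q (0 + x) (0 + y)
          + 𝔼 x ∈ walshKernel V r, 𝔼 y ∈ walshKernel V r, Q (0 + x) (w + y)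
          + 𝔼 x ∈ walshKernel V r, 𝔼 y ∈ walshKernel V r, Q (w + x) (0 + y)
          + 𝔼 x ∈ walshKernel V r, 𝔼 y ∈ walshKernel V r, Q (w + x) (w + y)) / 4 := by
      have e (x : Vec n) := hV.expect_eq_walshKernel hw hr (Q x)
      rw [hV.expect_eq_walshKernel hw hr]
      simp_rw [e, ← Finset.expect_div, Finset.expect_add_distrib]
      ring
    have s00 := sub 0 0
    have s01 := sub 0 w
    have s10 := sub w 0
    have s11 := sub w w
    rw [split ℓ, split fun x y => f x * g y * h (x + y)]
    simp only [add_add_add_comm] at s00 s01 s10 s11 ⊢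
    set f0 := 𝔼 x ∈ walshKernel V r, f (0 + x)
    set f1 := 𝔼 x ∈ walshKernel V r, f (w + x)
    set g0 := 𝔼 x ∈ walshKernel V r, g (0 + x)
    set g1 := 𝔼 x ∈ walshKernel V r, g (w + x)
    have henergy : (2 - (f0 ^ 2 + f1 ^ 2) / 2 - (g0 ^ 2 + g1 ^ 2) / 2) / ε ^ 2 + (j + 1 : ℕ)
        ≤ (2 - (𝔼 x ∈ V, f x) ^ 2 - (𝔼 x ∈ V, g x) ^ 2) / ε ^ 2 + j := by
      have e : (2 - (𝔼 x ∈ V, f x) ^ 2 - (𝔼 x ∈ V, g x) ^ 2) / ε ^ 2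
          = (2 - (𝔼 x ∈ V, f x) ^ 2 - (𝔼 x ∈ V, g x) ^ 2 - ε ^ 2) / ε ^ 2 + 1 := by
        field_simp
        ring
      have : (2 - (f0 ^ 2 + f1 ^ 2) / 2 - (g0 ^ 2 + g1 ^ 2) / 2) / ε ^ 2
          ≤ (2 - (𝔼 x ∈ V, f x) ^ 2 - (𝔼 x ∈ V, g x) ^ 2 - ε ^ 2) / ε ^ 2 := by
        gcongr ?_ / _
        linarith
      push_cast
      linarith
    have hdiv := div_le_div_of_nonneg_right henergy hD'.le
    have e4 : ((2 - (f0 ^ 2 + f1 ^ 2) / 2 - (g0 ^ 2 + g1 ^ 2) / 2) / ε ^ 2 + (j + 1 : ℕ)) / D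
        = (((2 - f0 ^ 2 - g0 ^ 2) / ε ^ 2 + (j + 1 : ℕ)) / D
          + ((2 - f0 ^ 2 - g1 ^ 2) / ε ^ 2 + (j + 1 : ℕ)) / D
          + ((2 - f1 ^ 2 - g0 ^ 2) / ε ^ 2 + (j + 1 : ℕ)) / D
          + ((2 - f1 ^ 2 - g1 ^ 2) / ε ^ 2 + (j + 1 : ℕ)) / D) / 4 := by
      ring
    rw [e4] at hdiv
    linarith

/-- The average loss is a constant fraction of the density of the event, up to small errors. -/
theorem le_expect_loss (H : LossSystem B f g h ℓ) {τ β σ : ℝ} (hτ : 0 < τ) (hσ : 0 < σ) {D : ℕ}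
    (hD : 0 < D) (hβ : (B.card : ℝ) * 2 ^ D / 2 ^ n ≤ β) :
    (𝔼 x, 𝔼 y, f x * g y * h (x + y)) / 16 - σ / 16 - (17 * τ + β) / (16 * σ ^ 3)
      - 8 / (τ ^ 4 * D) ≤ 𝔼 x, 𝔼 y, ℓ x y := by
  have hV : IsSub (Finset.univ : Finset (Vec n)) := ⟨by simp, by simp⟩
  have h1 := le_expect_loss_on_subspace hτ hσ hD hβ D (j := 0) H hV rfl (by simp [ZMod.card])
  have hD' : (0 : ℝ) < D := by exact_mod_cast hD
  have h2 : ((2 - (𝔼 x, f x) ^ 2 - (𝔼 x, g x) ^ 2) / (τ ^ 2 / 2) ^ 2 + (0 : ℕ)) / (D : ℝ)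
      ≤ 8 / (τ ^ 4 * D) := by
    have e : 8 / (τ ^ 4 * D) = (2 / (τ ^ 2 / 2) ^ 2 + (0 : ℕ)) / (D : ℝ) := by
      field_simp
      norm_num
    rw [e]
    gcongr
    linarith [sq_nonneg (𝔼 x, f x), sq_nonneg (𝔼 x, g x)]
  linarith

end LossSystem

/-- The vectors of Hamming weight less than `n / 4`. -/
def lightVec (n : ℕ) : Finset (Vec n) :=
  {u | 4 * Finset.card {i | u i = 1} < n}

lemma card_lightVec_le (n : ℕ) : ((lightVec n).card : ℝ) ≤ (337 / 192) ^ n := by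
  set t : ℝ := (3 / 4) ^ 4 with ht
  have h1 : ∑ u : Vec n, t ^ Finset.card {i | u i = 1} = (1 + t) ^ n := by
    have e (u : Vec n) : t ^ Finset.card {i | u i = 1} = ∏ i, if u i = 1 then t else 1 := by
      rw [Finset.prod_ite, Finset.prod_const, Finset.prod_const_one, mul_one]
    simp_rw [e]
    have h2 := Finset.prod_univ_sum (fun _ : Fin n => (Finset.univ : Finset (ZMod 2)))
      fun _ a => if a = 1 then t else 1
    rw [Fintype.piFinset_univ] at h2
    rw [← h2]
    have h3 : (Finset.univ : Finset (ZMod 2)) = {0, 1} := by decide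
    rw [h3, Finset.sum_pair (by decide)]
    simp
  have h2 : ((lightVec n).card : ℝ) * (3 / 4) ^ n ≤ (1 + t) ^ n := by
    rw [← h1, ← nsmul_eq_mul, ← Finset.sum_const]
    refine (Finset.sum_le_sum fun u hu => ?_).trans
      (Finset.sum_le_sum_of_subset_of_nonneg (Finset.subset_univ (lightVec n))
        fun u _ _ => by positivity)
    rw [ht, ← pow_mul]
    exact pow_le_pow_of_le_one (by norm_num) (by norm_num) (Finset.mem_filter.1 hu).2.le
  have h3 : (337 / 192 : ℝ) = (1 + t) / (3 / 4) := by rw [ht]; norm_num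
  rw [h3, div_pow, le_div_iff₀ (by positivity)]
  exact h2

lemma expect_expect_indicator {n : ℕ} (P : Vec n × Vec n → Prop) [DecidablePred P] :
    𝔼 x, 𝔼 y, (if P (x, y) then (1 : ℝ) else 0)
      = (Nat.card {p // P p} : ℝ) / 2 ^ (2 * n) := by
  rw [← Finset.expect_product' (f := fun x y => if P (x, y) then (1 : ℝ) else 0),
    Finset.expect_eq_sum_div_card, Nat.card_eq_fintype_card, Fintype.card_subtype]
  simp [ZMod.card, two_mul, pow_add]

/-- No strategy wins a coordinate on all four queries of a pattern flipping that coordinate. -/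
lemma not_winCoord_pattern {n : ℕ} (f1 f2 f3 : Vec n → Vec n) (x y u : Vec n) (i : Fin n)
    (hu : u i = 1) (h1 : winCoord f1 f2 f3 x y i) (h2 : winCoord f1 f2 f3 (x + u) y i)
    (h3 : winCoord f1 f2 f3 x (y + u) i) (h4 : winCoord f1 f2 f3 (x + u) (y + u) i) : False := by
  have e1 : x + u + y = x + y + u := by abel
  have e2 : x + (y + u) = x + y + u := by abel
  have e3 : x + u + (y + u) = x + y := by rw [add_add_add_comm, vec_add_self, add_zero]
  unfold winCoord at h1 h2 h3 h4
  rw [e1] at h2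
  rw [e2] at h3
  rw [e3] at h4
  simp only [Pi.add_apply, hu] at h1 h2 h3 h4
  have key : ∀ p q : ZMod 2, or3 p q (p + q) + or3 (p + 1) q (p + q + 1)
      + or3 p (q + 1) (p + q + 1) + or3 (p + 1) (q + 1) (p + q) = 1 := by
    unfold or3; decide
  have h0 := key (x i) (y i)
  rw [← h1, ← h2, ← h3, ← h4] at h0
  have dbl (a : ZMod 2) : a + a = 0 := CharTwo.add_self_eq_zero a
  have : (1 : ZMod 2) = 0 := by
    rw [← h0]
    linear_combination dbl (f1 x i) + dbl (f1 (x + u) i) + dbl (f2 y i) + dbl (f2 (y + u) i)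
      + dbl (f3 (x + y) i) + dbl (f3 (x + y + u) i)
  exact absurd this (by decide)

open Classical in
/-- The indicator that the query `(x, y)` lies in the event and coordinate `i` is lost. -/
noncomputable def coordLoss {n : ℕ} (E1 E2 E3 : Set (Vec n)) (i : Fin n)
    (φ : (Vec n → Vec n) × (Vec n → Vec n) × (Vec n → Vec n)) (x y : Vec n) : ℝ :=
  if (x, y) ∈ condSet E1 E2 E3 ∧ ¬ winCoord φ.1 φ.2.1 φ.2.2 x y i then 1 else 0

lemma coordLoss_mem_Icc {n : ℕ} (E1 E2 E3 : Set (Vec n)) (i : Fin n)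
    (φ : (Vec n → Vec n) × (Vec n → Vec n) × (Vec n → Vec n)) (x y : Vec n) :
    coordLoss E1 E2 E3 i φ x y ∈ Set.Icc (0 : ℝ) 1 := by
  unfold coordLoss
  split_ifs <;> simp

/-- Strategies for the individual coordinates give a loss system on the event. -/
lemma lossSystem_of_strategies {n : ℕ} (hn : 0 < n) (E1 E2 E3 : Set (Vec n))
    (φ : Fin n → (Vec n → Vec n) × (Vec n → Vec n) × (Vec n → Vec n)) :
    LossSystem (lightVec n) (E1.indicator 1) (E2.indicator 1) (E3.indicator 1)
      (fun x y => (∑ i, coordLoss E1 E2 E3 i (φ i) x y) / n) := by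
  have hn' : (0 : ℝ) < n := by exact_mod_cast hn
  have hind (E : Set (Vec n)) (x : Vec n) :
      E.indicator (1 : Vec n → ℝ) x = 0 ∨ E.indicator (1 : Vec n → ℝ) x = 1 := by
    classical
    rw [Set.indicator_apply]
    split_ifs <;> simp
  have hmem {E : Set (Vec n)} {x : Vec n} (h : E.indicator (1 : Vec n → ℝ) x = 1) : x ∈ E :=
    Set.mem_of_indicator_ne_zero (by rw [h]; exact one_ne_zero)
  refine ⟨hind E1, hind E2, hind E3, fun x y => ?_, fun x y => ?_, ?_⟩
  · exact div_nonneg (Finset.sum_nonneg fun i _ => (coordLoss_mem_Icc E1 E2 E3 i _ x y).1) hn'.le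
  · rw [div_le_one hn']
    calc ∑ i, coordLoss E1 E2 E3 i (φ i) x y ≤ ∑ _i : Fin n, (1 : ℝ) :=
          Finset.sum_le_sum fun i _ => (coordLoss_mem_Icc E1 E2 E3 i _ x y).2
      _ = n := by simp
  · intro x y u hu h1 h2 h3 h4 h5 h6
    have e1 : x + u + y = x + y + u := by abel
    have e2 : x + (y + u) = x + y + u := by abel
    have e3 : x + u + (y + u) = x + y := by rw [add_add_add_comm, vec_add_self, add_zero]
    have m1 : (x, y) ∈ condSet E1 E2 E3 := ⟨hmem h1, hmem h3, hmem h5⟩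
    have m2 : (x + u, y) ∈ condSet E1 E2 E3 :=
      ⟨hmem h2, hmem h3, show x + u + y ∈ E3 from e1 ▸ hmem h6⟩
    have m3 : (x, y + u) ∈ condSet E1 E2 E3 :=
      ⟨hmem h1, hmem h4, show x + (y + u) ∈ E3 from e2 ▸ hmem h6⟩
    have m4 : (x + u, y + u) ∈ condSet E1 E2 E3 :=
      ⟨hmem h2, hmem h4, show x + u + (y + u) ∈ E3 from e3 ▸ hmem h5⟩
    have hwt : n ≤ 4 * Finset.card {i | u i = 1} := by
      by_contra hlt
      exact hu (Finset.mem_filter.2 ⟨Finset.mem_univ u, not_le.1 hlt⟩)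
    have hwt' : (n : ℝ) ≤ 4 * ∑ i, if u i = 1 then (1 : ℝ) else 0 := by
      rw [Finset.sum_boole]
      exact_mod_cast hwt
    have hpt : ∑ i, (if u i = 1 then (1 : ℝ) else 0)
        ≤ ∑ i, (coordLoss E1 E2 E3 i (φ i) x y + coordLoss E1 E2 E3 i (φ i) (x + u) y
          + coordLoss E1 E2 E3 i (φ i) x (y + u)
          + coordLoss E1 E2 E3 i (φ i) (x + u) (y + u)) := by
      refine Finset.sum_le_sum fun i _ => ?_
      have p1 := (coordLoss_mem_Icc E1 E2 E3 i (φ i) x y).1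
      have p2 := (coordLoss_mem_Icc E1 E2 E3 i (φ i) (x + u) y).1
      have p3 := (coordLoss_mem_Icc E1 E2 E3 i (φ i) x (y + u)).1
      have p4 := (coordLoss_mem_Icc E1 E2 E3 i (φ i) (x + u) (y + u)).1
      have lost {x y : Vec n} (hm : (x, y) ∈ condSet E1 E2 E3)
          (hw : ¬ winCoord (φ i).1 (φ i).2.1 (φ i).2.2 x y i) :
          coordLoss E1 E2 E3 i (φ i) x y = 1 := if_pos ⟨hm, hw⟩
      split_ifs with hui
      · by_contra! hlt
        refine not_winCoord_pattern (φ i).1 (φ i).2.1 (φ i).2.2 x y u i hui ?_ ?_ ?_ ?_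
        · by_contra hw
          linarith [lost m1 hw]
        · by_contra hw
          linarith [lost m2 hw]
        · by_contra hw
          linarith [lost m3 hw]
        · by_contra hw
          linarith [lost m4 hw]
      · linarith
    simp only [Finset.sum_add_distrib] at hpt
    rw [← add_div, ← add_div, ← add_div, ← mul_div_assoc, le_div_iff₀ hn']
    linarith

lemma expect_coordLoss {n : ℕ} (E1 E2 E3 : Set (Vec n)) (i : Fin n)
    (φ : (Vec n → Vec n) × (Vec n → Vec n) × (Vec n → Vec n)) :
    𝔼 x, 𝔼 y, coordLoss E1 E2 E3 i φ x y = probE E1 E2 E3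
      - (Nat.card {p : Vec n × Vec n // p ∈ condSet E1 E2 E3 ∧
        winCoord φ.1 φ.2.1 φ.2.2 p.1 p.2 i} : ℝ) / 2 ^ (2 * n) := by
  classical
  have h1 := expect_expect_indicator fun p : Vec n × Vec n => p ∈ condSet E1 E2 E3
  have h2 := expect_expect_indicator fun p : Vec n × Vec n =>
    p ∈ condSet E1 E2 E3 ∧ winCoord φ.1 φ.2.1 φ.2.2 p.1 p.2 i
  rw [← h2, probE]
  refine Eq.trans ?_ (congrArg (· - _) h1)
  simp_rw [← Finset.expect_sub_distrib]
  refine Finset.expect_congr rfl fun x _ => Finset.expect_congr rfl fun y _ => ?_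
  unfold coordLoss
  by_cases hm : (x, y) ∈ condSet E1 E2 E3 <;>
    by_cases hw : winCoord φ.1 φ.2.1 φ.2.2 x y i <;> simp [hm, hw]

lemma exists_expect_coordLoss_eq {n : ℕ} (E1 E2 E3 : Set (Vec n)) (hE : 0 < probE E1 E2 E3)
    (i : Fin n) : ∃ φ, 𝔼 x, 𝔼 y, coordLoss E1 E2 E3 i φ x y
      = probE E1 E2 E3 * (1 - valCoord E1 E2 E3 i) := by
  obtain ⟨φ, hφ⟩ := exists_eq_ciSup_of_finite
    (f := fun f : (Vec n → Vec n) × (Vec n → Vec n) × (Vec n → Vec n) =>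
      (Nat.card {p : Vec n × Vec n // p ∈ condSet E1 E2 E3 ∧
        winCoord f.1 f.2.1 f.2.2 p.1 p.2 i} : ℝ) / (Nat.card (condSet E1 E2 E3) : ℝ))
  refine ⟨φ, ?_⟩
  have hS : (Nat.card (condSet E1 E2 E3) : ℝ) ≠ 0 := fun h0 => by
    rw [probE, h0, zero_div] at hE
    exact lt_irrefl _ hE
  rw [expect_coordLoss, valCoord, ← hφ, probE]
  field_simp

lemma expect_indicators_eq_probE {n : ℕ} (E1 E2 E3 : Set (Vec n)) :
    𝔼 x, 𝔼 y, E1.indicator (1 : Vec n → ℝ) x * E2.indicator (1 : Vec n → ℝ) y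
      * E3.indicator (1 : Vec n → ℝ) (x + y) = probE E1 E2 E3 := by
  classical
  refine Eq.trans ?_ (expect_expect_indicator fun p : Vec n × Vec n => p ∈ condSet E1 E2 E3)
  refine Finset.expect_congr rfl fun x _ => Finset.expect_congr rfl fun y _ => ?_
  simp only [Set.indicator_apply, condSet, Set.mem_ofPred_eq, Pi.one_apply]
  by_cases h1 : x ∈ E1 <;> by_cases h2 : y ∈ E2 <;> by_cases h3 : x + y ∈ E3 <;>
    simp [h1, h2, h3]

/-- A lower bound on the average loss bounds the average value of the coordinates. -/
lemma average_valCoord_le {n : ℕ} (hn : 0 < n) (E1 E2 E3 : Set (Vec n))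
    (hE : 0 < probE E1 E2 E3) {c : ℝ}
    (h : ∀ ℓ : Vec n → Vec n → ℝ, LossSystem (lightVec n) (E1.indicator 1) (E2.indicator 1)
      (E3.indicator 1) ℓ → c * probE E1 E2 E3 ≤ 𝔼 x, 𝔼 y, ℓ x y) :
    (1 / (n : ℝ)) * ∑ i : Fin n, valCoord E1 E2 E3 i ≤ 1 - c := by
  have hn' : (0 : ℝ) < n := by exact_mod_cast hn
  choose φ hφ using exists_expect_coordLoss_eq E1 E2 E3 hE
  have h1 := h _ (lossSystem_of_strategies hn E1 E2 E3 φ)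
  simp_rw [← Finset.expect_div, Finset.expect_sum_comm, hφ] at h1
  rw [← Finset.mul_sum, Finset.sum_sub_distrib, le_div_iff₀ hn'] at h1
  have h2 : c * n ≤ ∑ _i : Fin n, (1 : ℝ) - ∑ i, valCoord E1 E2 E3 i :=
    le_of_mul_le_mul_left (by linarith) hE
  rw [Finset.sum_const, Finset.card_univ, Fintype.card_fin, nsmul_eq_mul, mul_one] at h2
  rw [one_div, inv_mul_le_iff₀ hn']
  linarith

/-- With `D` at most `n / 12`, the light vectors stay negligible in subspaces of
codimension `D`. -/
lemma card_lightVec_mul_le {n D : ℕ} (hD : 12 * D ≤ n) :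
    ((lightVec n).card : ℝ) * 2 ^ D / 2 ^ n ≤ (47 / 50) ^ n := by
  have h1 : (2 : ℝ) ^ D * (47 / 50) ^ n ≤ 1 := by
    calc (2 : ℝ) ^ D * (47 / 50) ^ n ≤ 2 ^ D * (47 / 50) ^ (12 * D) := by
          gcongr ?_ * ?_
          exact pow_le_pow_of_le_one (by norm_num) (by norm_num) hD
      _ = (2 * (47 / 50) ^ 12) ^ D := by rw [pow_mul, mul_pow]
      _ ≤ 1 := pow_le_one₀ (by norm_num) (by norm_num)
  rw [div_le_iff₀ (by positivity)]
  calc ((lightVec n).card : ℝ) * 2 ^ D ≤ (337 / 192) ^ n * 2 ^ D := by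
        gcongr
        exact card_lightVec_le n
    _ ≤ ((47 / 50) * (47 / 50) * 2) ^ n * 2 ^ D := by
        gcongr
        norm_num
    _ = (47 / 50) ^ n * 2 ^ n * (2 ^ D * (47 / 50) ^ n) := by
        rw [mul_pow, mul_pow]; ring
    _ ≤ (47 / 50) ^ n * 2 ^ n := mul_le_of_le_one_right (by positivity) h1

lemma average_valCoord_le_of_parameters {n D : ℕ} {α : ℝ} (hn : 0 < n) (hα : 0 < α)
    (hα' : α ≤ 1 / 200000) (hD : (α ^ 22)⁻¹ ≤ D) (hDn : 12 * D ≤ n)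
    (hlight : (47 / 50 : ℝ) ^ n ≤ α ^ 5) (E1 E2 E3 : Set (Vec n)) (hE : α ≤ probE E1 E2 E3) :
    (1 / (n : ℝ)) * ∑ i : Fin n, valCoord E1 E2 E3 i ≤ 19 / 20 := by
  have hD0 : (0 : ℝ) < D := lt_of_lt_of_le (by positivity) hD
  have main := average_valCoord_le hn E1 E2 E3 (hα.trans_le hE) (c := 1 / 20) fun ℓ H => by
    have h1 := H.le_expect_loss (τ := α ^ 5) (σ := α / 10) (by positivity) (by positivity)
      (by exact_mod_cast hD0) ((card_lightVec_mul_le hDn).trans hlight)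
    rw [expect_indicators_eq_probE] at h1
    have h2 : (17 * α ^ 5 + α ^ 5) / (16 * (α / 10) ^ 3) = 1125 * α ^ 2 := by
      field_simp
      norm_num
    have h3 : 8 / ((α ^ 5) ^ 4 * D) ≤ 8 * α ^ 2 := by
      rw [div_le_iff₀ (by positivity)]
      rw [inv_le_iff_one_le_mul₀ (by positivity)] at hD
      calc (8 : ℝ) = 8 * 1 := by ring
        _ ≤ 8 * (D * α ^ 22) := by gcongr
        _ = _ := by ring
    rw [h2] at h1
    have h4 : α ^ 2 ≤ α * (1 / 200000) := by
      rw [sq]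
      gcongr
    linarith
  linarith

/-- For all large `n` and all product events `E = E1 × E2 × E3` of probability at least
`n ^ (-1/100)`, the average over coordinates of `val^{(i)}(G | E)` is at most `19/20`. -/
theorem ghz_average_coordinate_value :
    ∃ N : ℕ, ∀ n : ℕ, N ≤ n → ∀ E1 E2 E3 : Set (Vec n),
      (n : ℝ) ^ (-(1 / 100 : ℝ)) ≤ probE E1 E2 E3 →
      (1 / (n : ℝ)) * ∑ i : Fin n, valCoord E1 E2 E3 i ≤ 19 / 20 := by
  have htend : Filter.Tendsto (fun n : ℕ => (n : ℝ) ^ (-(1 / 100 : ℝ))) Filter.atTop (nhds 0) :=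
    (tendsto_rpow_neg_atTop (by norm_num)).comp tendsto_natCast_atTop_atTop
  have hα_small := htend.eventually_le_const (show (0 : ℝ) < 1 / 200000 by norm_num)
  have hgeom := (tendsto_self_mul_const_pow_of_lt_one (r := (47 / 50 : ℝ)) (by norm_num)
    (by norm_num)).eventually_le_const one_pos
  obtain ⟨N, hN⟩ := Filter.eventually_atTop.1
    ((hα_small.and hgeom).and (Filter.eventually_ge_atTop 1000))
  refine ⟨N, fun n hn E1 E2 E3 hE => ?_⟩
  obtain ⟨⟨hα_le, hgeom_le⟩, hn1000⟩ := hN n hn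
  have hn1000' : (1000 : ℝ) ≤ n := by exact_mod_cast hn1000
  have hn0 : (0 : ℝ) < n := by linarith
  have hpow (k : ℕ) : ((n : ℝ) ^ (-(1 / 100 : ℝ))) ^ k = (n : ℝ) ^ (-(k / 100 : ℝ)) := by
    rw [← Real.rpow_natCast, ← Real.rpow_mul hn0.le]
    congr 1
    ring
  refine average_valCoord_le_of_parameters (D := ⌈(((n : ℝ) ^ (-(1 / 100 : ℝ))) ^ 22)⁻¹⌉₊)
    (by lia) (Real.rpow_pos_of_pos hn0 _) hα_le (Nat.le_ceil _) ?_ ?_ E1 E2 E3 hE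
  · have h1 : (((n : ℝ) ^ (-(1 / 100 : ℝ))) ^ 22)⁻¹ ≤ √n := by
      rw [hpow, ← Real.rpow_neg hn0.le, Real.sqrt_eq_rpow]
      exact Real.rpow_le_rpow_of_exponent_le (by linarith) (by norm_num)
    have h2 := (Nat.ceil_lt_add_one
      (show 0 ≤ (((n : ℝ) ^ (-(1 / 100 : ℝ))) ^ 22)⁻¹ by positivity)).le
    have h3 : (20 : ℝ) ≤ √n := Real.le_sqrt_of_sq_le (by linarith)
    have h4 := Real.mul_self_sqrt hn0.le
    have h5 : 12 * (⌈(((n : ℝ) ^ (-(1 / 100 : ℝ))) ^ 22)⁻¹⌉₊ : ℝ) ≤ n := by nlinarith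
    exact_mod_cast h5
  · calc (47 / 50 : ℝ) ^ n ≤ (n : ℝ) ^ (-1 : ℝ) := by
          rw [Real.rpow_neg_one, ← one_div, le_div_iff₀ hn0]
          linarith
      _ ≤ _ := by
          rw [hpow]
          exact Real.rpow_le_rpow_of_exponent_le (by linarith) (by norm_num)
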